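/- arXiv:2311.07681 — 2 statements merged into one kernel-verified Lean document; each statement's English description precedes it below -/
import Mathlib

section
/- Theta transformation formula with characteristic (slice form of Theorem 4.7): let d ≥ 1, let A be an invertible real d×d matrix, let z ∈ ℂ with Im z > 0 and let w ∈ ℂ^d. Then ∑_{m∈ℤ^d} exp(πi·z·∑_{j=1}^d ((Am)_j + w_j)²) = (−iz)^{−d/2} · |det A|⁻¹ · ∑_{k∈ℤ^d} exp(−πi‖(Aᵀ)⁻¹k‖²·z⁻¹ + 2πi·∑_{j=1}^d ((Aᵀ)⁻¹k)_j·w_j). -/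
open Matrix

section Poisson

open MeasureTheory Set

variable {ι : Type*} [Fintype ι]

/-- The integral over `ℝ^ι` is the sum of the integrals over the integral translates of the unit
cube. -/
theorem hasSum_setIntegral_unitCube {g : (ι → ℝ) → ℂ} (hg : Integrable g) :
    HasSum (fun n : ι → ℤ ↦ ∫ x in {x : ι → ℝ | ∀ i, x i ∈ Ioc (0 : ℝ) (0 + 1)},
      g (x + fun i ↦ (n i : ℝ))) (∫ x, g x) := by
  set Q : Set (ι → ℝ) := {x | ∀ i, x i ∈ Ioc (0 : ℝ) (0 + 1)} with hQ
  have hQm : MeasurableSet Q := MeasurableSet.univ_pi' fun _ ↦ measurableSet_Ioc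
  let s : (ι → ℤ) → Set (ι → ℝ) := fun n ↦ (fun x ↦ x + fun i ↦ (-n i : ℝ)) ⁻¹' Q
  have hs_mem (n : ι → ℤ) (x : ι → ℝ) : x ∈ s n ↔ ∀ i, ⌈x i⌉ = n i + 1 := by
    simp only [s, hQ, mem_preimage, mem_ofPred_eq, Pi.add_apply, mem_Ioc, Int.ceil_eq_iff]
    refine forall_congr' fun i ↦ ?_
    push_cast
    constructor <;> rintro ⟨h1, h2⟩ <;> constructor <;> linarith
  have hsm (n) : MeasurableSet (s n) := hQm.preimage (by fun_prop)
  have hd : Pairwise (Function.onFun Disjoint s) := by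
    intro m n hmn
    refine Set.disjoint_left.mpr fun x hm hn ↦ hmn (funext fun i ↦ ?_)
    rw [hs_mem] at hm hn
    linarith [hm i, hn i]
  have hU : ⋃ n, s n = univ := by
    refine eq_univ_of_forall fun x ↦ mem_iUnion.mpr ⟨fun i ↦ ⌈x i⌉ - 1, ?_⟩
    rw [hs_mem]
    intro i
    ring
  have key := hasSum_integral_iUnion (μ := volume) hsm hd (f := g) hg.integrableOn
  rw [hU, setIntegral_univ] at key
  convert! key using 2 with n
  have := (measurePreserving_add_right (volume : Measure (ι → ℝ)) (fun i ↦ (n i : ℝ)))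
    |>.setIntegral_preimage_emb (measurableEmbedding_addRight _) g (s n)
  rw [← this]
  congr 2
  ext x
  simp [s, hQ]

/-- The monomials on the torus, pulled back to `ℝ^ι`. -/
theorem mFourier_coe_apply (n : ι → ℤ) (x : ι → ℝ) :
    UnitAddTorus.mFourier n (fun i ↦ (x i : UnitAddCircle)) =
      Complex.exp (2 * Real.pi * Complex.I * ∑ i, (n i : ℂ) * x i) := by
  simp only [UnitAddTorus.mFourier, ContinuousMap.coe_mk, fourier_coe_apply, Finset.mul_sum,
    Complex.exp_sum]
  refine Finset.prod_congr rfl fun i _ ↦ ?_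
  congr 1
  push_cast
  ring

/-- **Poisson summation** on `ℤ^ι`, for a continuous integrable function whose integral translates
are locally uniformly summable and whose Fourier transform is summable over `ℤ^ι`. -/
theorem tsum_eq_tsum_integral_exp {f : (ι → ℝ) → ℂ} (hf : Continuous f) (hfi : Integrable f)
    (hloc : ∀ R : ℝ, ∃ u : (ι → ℤ) → ℝ, Summable u ∧
      ∀ x, ‖x‖ ≤ R → ∀ n : ι → ℤ, ‖f (x + fun i ↦ (n i : ℝ))‖ ≤ u n)
    (hsum : Summable fun k : ι → ℤ ↦
      ∫ x : ι → ℝ, Complex.exp (-2 * Real.pi * Complex.I * ∑ i, (k i : ℂ) * x i) * f x) :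
    ∑' n : ι → ℤ, f (fun i ↦ (n i : ℝ)) = ∑' k : ι → ℤ,
      ∫ x : ι → ℝ, Complex.exp (-2 * Real.pi * Complex.I * ∑ i, (k i : ℂ) * x i) * f x := by
  have hGc : Continuous fun x : ι → ℝ ↦ ∑' n : ι → ℤ, f (x + fun i ↦ (n i : ℝ)) := by
    refine continuous_iff_continuousAt.mpr fun x ↦ ?_
    obtain ⟨u, hu, hb⟩ := hloc (‖x‖ + 1)
    refine ContinuousOn.continuousAt (s := Metric.closedBall 0 (‖x‖ + 1)) ?_ ?_
    · refine continuousOn_tsum (fun n ↦ by fun_prop) hu fun n y hy ↦ hb y ?_ n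
      simpa using hy
    · exact Metric.closedBall_mem_nhds_of_mem (by simp)
  let G : C(ι → ℝ, ℂ) := ⟨_, hGc⟩
  let π : C(ι → ℝ, UnitAddTorus ι) :=
    ⟨Pi.map fun _ (t : ℝ) ↦ (t : UnitAddCircle), .piMap fun _ ↦ AddCircle.continuous_mk' 1⟩
  have hπ : Topology.IsQuotientMap π :=
    (IsOpenQuotientMap.piMap fun _ : ι ↦
      QuotientAddGroup.isOpenQuotientMap_mk (N := AddSubgroup.zmultiples (1 : ℝ))).isQuotientMap
  have hG : Function.FactorsThrough G π := by
    intro a b hab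
    have h (i) : ∃ m : ℤ, a i = b i + m := by
      have := congrFun hab i
      obtain ⟨m, hm⟩ := (AddCircle.coe_eq_zero_iff (1 : ℝ) (x := a i - b i)).mp (by
        rw [AddCircle.coe_sub, sub_eq_zero]; exact this)
      exact ⟨m, by simp at hm; linarith⟩
    choose m hm using h
    obtain rfl : a = b + fun i ↦ (m i : ℝ) := funext hm
    change ∑' n : ι → ℤ, f _ = ∑' n : ι → ℤ, f _
    rw [← (Equiv.addLeft m).tsum_eq fun n : ι → ℤ ↦ f (b + fun i ↦ (n i : ℝ))]
    refine tsum_congr fun n ↦ congrArg f (funext fun i ↦ ?_)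
    simp [add_assoc]
  let F : C(UnitAddTorus ι, ℂ) := hπ.lift G hG
  have hF (x : ι → ℝ) : F (fun i ↦ (x i : UnitAddCircle)) =
      ∑' n : ι → ℤ, f (x + fun i ↦ (n i : ℝ)) :=
    congrArg (fun g : C(ι → ℝ, ℂ) ↦ g x) (hπ.lift_comp G hG)
  have hcoeff (k : ι → ℤ) : UnitAddTorus.mFourierCoeff F k =
      ∫ x : ι → ℝ, Complex.exp (-2 * Real.pi * Complex.I * ∑ i, (k i : ℂ) * x i) * f x := by
    set e : (ι → ℝ) → ℂ := fun x ↦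
      Complex.exp (-2 * Real.pi * Complex.I * ∑ i, (k i : ℂ) * x i) with he
    have he_mk (x : ι → ℝ) :
        UnitAddTorus.mFourier (-k) (fun i ↦ (x i : UnitAddCircle)) = e x := by
      rw [mFourier_coe_apply, he]
      simp
    have he_norm (x) : ‖e x‖ = 1 := by
      simp [he, Complex.norm_exp]
    have he_add (x : ι → ℝ) (n : ι → ℤ) : e (x + fun i ↦ (n i : ℝ)) = e x := by
      rw [← he_mk, ← he_mk]
      congr 1
      ext i
      simp
    have hec : Continuous e := by fun_prop
    have hgi : Integrable fun x ↦ e x * f x :=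
      hfi.bdd_mul (c := 1) hec.aestronglyMeasurable (.of_forall fun x ↦ (he_norm x).le)
    rw [UnitAddTorus.mFourierCoeff_eq_integral F k 0, ← (hasSum_setIntegral_unitCube hgi).tsum_eq]
    simp_rw [hF, he_mk, smul_eq_mul, he_add, Pi.zero_apply]
    set Q : Set (ι → ℝ) := {x | ∀ i, x i ∈ Ioc (0 : ℝ) (0 + 1)} with hQ
    have hQm : MeasurableSet Q := MeasurableSet.univ_pi' fun _ ↦ measurableSet_Ioc
    have hQR (x) (hx : x ∈ Q) : ‖x‖ ≤ 1 := by
      refine (pi_norm_le_iff_of_nonneg zero_le_one).mpr fun i ↦ ?_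
      have := hx i
      rw [zero_add, mem_Ioc] at this
      rw [Real.norm_eq_abs, abs_le]
      constructor <;> linarith
    have hQv : volume Q < ⊤ :=
      ((Metric.isBounded_closedBall (x := (0 : ι → ℝ)) (r := 1)).subset fun x hx ↦ by
        simpa using hQR x hx).measure_lt_top
    obtain ⟨u, hu, hb⟩ := hloc 1
    simp_rw [← tsum_mul_left]
    have hbound (n : ι → ℤ) (x) (hx : x ∈ Q) : ‖e x * f (x + fun i ↦ (n i : ℝ))‖ ≤ u n := by
      rw [norm_mul, he_norm, one_mul]
      exact hb x (hQR x hx) n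
    have hint (n : ι → ℤ) : IntegrableOn (fun x ↦ e x * f (x + fun i ↦ (n i : ℝ))) Q :=
      Measure.integrableOn_of_bounded hQv.ne (by fun_prop)
        ((ae_restrict_iff' hQm).mpr (.of_forall (hbound n)))
    refine (integral_tsum_of_summable_integral_norm hint ?_).symm
    refine Summable.of_nonneg_of_le (fun n ↦ integral_nonneg fun _ ↦ norm_nonneg _) (fun n ↦ ?_)
      (hu.mul_right (volume.real Q))
    refine (le_abs_self _).trans ?_
    exact norm_setIntegral_le_of_norm_le_const
      (f := fun x ↦ ‖e x * f (x + fun i ↦ (n i : ℝ))‖) hQv fun x hx ↦ by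
        simpa only [norm_norm] using hbound n x hx
  have hs : Summable (UnitAddTorus.mFourierCoeff F) := by
    rw [funext hcoeff]
    exact hsum
  have key := (UnitAddTorus.hasSum_mFourier_series_apply_of_summable hs
    (fun _ ↦ ((0 : ℝ) : UnitAddCircle))).tsum_eq
  rw [hF fun _ ↦ 0] at key
  simp only [mFourier_coe_apply _ (fun _ ↦ 0), hcoeff] at key
  simpa [Pi.add_def] using key.symm

end Poisson

section Gaussian

open MeasureTheory

theorem summable_fin_prod {α : Type*} {f : α → ℝ} (hf : Summable f) (hf0 : 0 ≤ f) (d : ℕ) :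
    Summable fun n : Fin d → α ↦ ∏ i, f (n i) := by
  induction d with
  | zero => exact Summable.of_finite
  | succ d ih =>
    rw [← (Fin.consEquiv fun _ ↦ α).summable_iff]
    convert! hf.mul_of_nonneg ih hf0 fun n ↦ Finset.prod_nonneg fun i _ ↦ hf0 _ using 2 with x
    simp [Fin.consEquiv, Fin.prod_univ_succ]

theorem summable_exp_neg_mul_sum_sq {c : ℝ} (hc : 0 < c) (d : ℕ) :
    Summable fun n : Fin d → ℤ ↦ Real.exp (-c * ∑ i, (n i : ℝ) ^ 2) := by
  have h := ((summable_jacobiTheta₂_term_iff 0 (Complex.I * (c / Real.pi : ℝ))).mpr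
    (by simpa using div_pos hc Real.pi_pos)).norm
  have h1 : Summable fun n : ℤ ↦ Real.exp (-c * (n : ℝ) ^ 2) := by
    convert! h using 2 with n
    rw [norm_jacobiTheta₂_term]
    congr 1
    rw [Complex.I_mul_im, Complex.ofReal_re, Complex.zero_im]
    field_simp
    ring
  convert! summable_fin_prod h1 (fun _ ↦ (Real.exp_pos _).le) d using 2 with n
  rw [Finset.mul_sum, Real.exp_sum]

theorem norm_cexp_quadratic_le {z : ℂ} (hz : 0 < z.im) (w : ℂ) :
    ∃ C : ℝ, ∀ u : ℝ, ‖Complex.exp (Real.pi * Complex.I * z * ((u : ℂ) + w) ^ 2)‖ ≤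
      Real.exp (C - Real.pi * z.im / 2 * u ^ 2) := by
  obtain ⟨x, y⟩ := z
  obtain ⟨a, b⟩ := w
  simp only at hz
  refine ⟨Real.pi * ((2 * a * y + 2 * x * b) ^ 2 / (2 * y) - (y * (a ^ 2 - b ^ 2) + 2 * x * a * b)),
    fun u ↦ ?_⟩
  rw [Complex.norm_exp, Real.exp_le_exp]
  have hre : (Real.pi * Complex.I * ⟨x, y⟩ * ((u : ℂ) + ⟨a, b⟩) ^ 2 : ℂ).re =
      -Real.pi * (y * ((u + a) ^ 2 - b ^ 2) + 2 * x * (u + a) * b) := by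
    simp [pow_two]
    ring
  rw [hre]
  have hsq : 0 ≤ (y * u + (2 * a * y + 2 * x * b)) ^ 2 / (2 * y) := by positivity
  have hexp : (y * u + (2 * a * y + 2 * x * b)) ^ 2 / (2 * y) =
      y * u ^ 2 / 2 + u * (2 * a * y + 2 * x * b) + (2 * a * y + 2 * x * b) ^ 2 / (2 * y) := by
    field_simp
    ring
  rw [hexp] at hsq
  nlinarith [mul_nonneg Real.pi_pos.le hsq]

/-- Coordinates are controlled by their image under an invertible matrix. -/
theorem sum_sq_le_mul_sum_mulVec_sq {d : ℕ} {A : Matrix (Fin d) (Fin d) ℝ} (hA : IsUnit A.det) :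
    ∃ K : ℝ, 0 < K ∧ ∀ x : Fin d → ℝ, ∑ i, x i ^ 2 ≤ K * ∑ j, (A *ᵥ x) j ^ 2 := by
  refine ⟨∑ i, ∑ j, A⁻¹ i j ^ 2 + 1, by positivity, fun x ↦ ?_⟩
  have hx : x = A⁻¹ *ᵥ (A *ᵥ x) := by
    rw [Matrix.mulVec_mulVec, Matrix.nonsing_inv_mul A hA, Matrix.one_mulVec]
  have h0 : 0 ≤ ∑ j, (A *ᵥ x) j ^ 2 := by positivity
  calc ∑ i, x i ^ 2 = ∑ i, (∑ j, A⁻¹ i j * (A *ᵥ x) j) ^ 2 := by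
        conv_lhs => rw [hx]
        rfl
    _ ≤ ∑ i, (∑ j, A⁻¹ i j ^ 2) * ∑ j, (A *ᵥ x) j ^ 2 :=
        Finset.sum_le_sum fun i _ ↦ Finset.sum_mul_sq_le_sq_mul_sq _ _ _
    _ ≤ _ := by
        rw [← Finset.sum_mul]
        gcongr
        linarith

/-- The theta summand, as a function of a real variable. -/
noncomputable def thetaGaussian {d : ℕ} (A : Matrix (Fin d) (Fin d) ℝ) (z : ℂ) (w : Fin d → ℂ)
    (x : Fin d → ℝ) : ℂ :=
  Complex.exp (Real.pi * Complex.I * z * ∑ j, (((A *ᵥ x) j : ℂ) + w j) ^ 2)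

variable {d : ℕ} {A : Matrix (Fin d) (Fin d) ℝ} {z : ℂ} {w : Fin d → ℂ}

theorem continuous_thetaGaussian : Continuous (thetaGaussian A z w) := by
  unfold thetaGaussian
  have : Continuous fun x : Fin d → ℝ ↦ A *ᵥ x :=
    continuous_const.matrix_mulVec continuous_id
  fun_prop

theorem norm_thetaGaussian_le (hA : IsUnit A.det) (hz : 0 < z.im) (w : Fin d → ℂ) :
    ∃ C c : ℝ, 0 < c ∧ ∀ x, ‖thetaGaussian A z w x‖ ≤ Real.exp (C - c * ∑ i, x i ^ 2) := by
  choose C hC using fun j ↦ norm_cexp_quadratic_le hz (w j)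
  obtain ⟨K, hK, hKA⟩ := sum_sq_le_mul_sum_mulVec_sq hA
  refine ⟨∑ j, C j, Real.pi * z.im / 2 / K, by positivity, fun x ↦ ?_⟩
  rw [thetaGaussian, Finset.mul_sum, Complex.exp_sum, norm_prod]
  refine (Finset.prod_le_prod (fun _ _ ↦ norm_nonneg _) fun j _ ↦ hC j _).trans ?_
  rw [← Real.exp_sum, Finset.sum_sub_distrib, ← Finset.mul_sum, Real.exp_le_exp,
    div_mul_eq_mul_div _ K, mul_div_assoc _ _ K]
  have hx := (div_le_iff₀' hK).mpr (hKA x)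
  exact sub_le_sub_left (mul_le_mul_of_nonneg_left hx (by positivity)) _

theorem integrable_thetaGaussian (hA : IsUnit A.det) (hz : 0 < z.im) (w : Fin d → ℂ) :
    Integrable (thetaGaussian A z w) := by
  obtain ⟨C, c, hc, hb⟩ := norm_thetaGaussian_le hA hz w
  have h := (GaussianFourier.integrable_cexp_neg_mul_sum_add (ι := Fin d) (b := c)
    (by simpa using hc) 0).norm.const_mul (Real.exp C)
  refine h.mono' continuous_thetaGaussian.aestronglyMeasurable (.of_forall fun x ↦ ?_)
  refine (hb x).trans_eq ?_
  rw [sub_eq_add_neg, Real.exp_add, Complex.norm_exp]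
  congr 2
  simp only [Pi.zero_apply, zero_mul, Finset.sum_const_zero, add_zero]
  norm_cast
  ring

theorem thetaGaussian_locally_summable (hA : IsUnit A.det) (hz : 0 < z.im) (w : Fin d → ℂ)
    (R : ℝ) : ∃ u : (Fin d → ℤ) → ℝ, Summable u ∧ ∀ x, ‖x‖ ≤ R → ∀ n : Fin d → ℤ,
      ‖thetaGaussian A z w (x + fun i ↦ (n i : ℝ))‖ ≤ u n := by
  obtain ⟨C, c, hc, hb⟩ := norm_thetaGaussian_le hA hz w
  refine ⟨fun n ↦ Real.exp (C + c * (d * R ^ 2)) * Real.exp (-(c / 2) * ∑ i, (n i : ℝ) ^ 2),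
    (summable_exp_neg_mul_sum_sq (half_pos hc) d).mul_left _, fun x hx n ↦ (hb _).trans ?_⟩
  beta_reduce
  rw [← Real.exp_add, Real.exp_le_exp]
  have h : ∑ i, ((n i : ℝ) ^ 2 / 2 - R ^ 2) ≤ ∑ i, (x + fun i ↦ (n i : ℝ)) i ^ 2 := by
    refine Finset.sum_le_sum fun i _ ↦ ?_
    have h1 : x i ^ 2 ≤ R ^ 2 :=
      sq_le_sq' (abs_le.mp ((norm_le_pi_norm x i).trans hx)).1
        (abs_le.mp ((norm_le_pi_norm x i).trans hx)).2
    rw [Pi.add_apply]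
    nlinarith [sq_nonneg (2 * x i + n i)]
  rw [Finset.sum_sub_distrib, ← Finset.sum_div, Finset.sum_const, Finset.card_univ,
    Fintype.card_fin, nsmul_eq_mul] at h
  nlinarith [mul_le_mul_of_nonneg_left h hc.le]

theorem summable_thetaGaussian (hA : IsUnit A.det) (hz : 0 < z.im) (w : Fin d → ℂ) :
    Summable fun n : Fin d → ℤ ↦ thetaGaussian A z w fun i ↦ (n i : ℝ) := by
  obtain ⟨u, hu, hb⟩ := thetaGaussian_locally_summable hA hz w 0
  exact hu.of_norm_bounded fun n ↦ by simpa using hb 0 (by simp) n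

theorem integral_comp_mulVec (hA : IsUnit A.det) {g : (Fin d → ℝ) → ℂ} (hg : Continuous g) :
    ∫ x, g (A *ᵥ x) = ((|A.det| : ℝ)⁻¹ : ℂ) * ∫ y, g y := by
  have h := integral_map (μ := (volume : Measure (Fin d → ℝ))) (φ := Matrix.toLin' A)
    (LinearMap.continuous_of_finiteDimensional _).aemeasurable (f := g) hg.aestronglyMeasurable
  rw [Real.map_matrix_volume_pi_eq_smul_volume_pi hA.ne_zero, integral_smul_measure,
    ENNReal.toReal_ofReal (abs_nonneg _), abs_inv] at h
  simp only [Matrix.toLin'_apply] at h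
  rw [← h, Complex.real_smul, Complex.ofReal_inv]

theorem fourier_thetaGaussian (hA : IsUnit A.det) (hz : 0 < z.im) (w : Fin d → ℂ)
    (k : Fin d → ℝ) :
    ∫ x : Fin d → ℝ, Complex.exp (-2 * Real.pi * Complex.I * ∑ i, (k i : ℂ) * x i) *
        thetaGaussian A z w x =
      (-Complex.I * z) ^ (-(d : ℂ) / 2) * ((|A.det| : ℝ)⁻¹ : ℂ) *
        Complex.exp (-(Real.pi : ℂ) * Complex.I * ((∑ j, ((Aᵀ)⁻¹ *ᵥ k) j ^ 2 : ℝ) : ℂ) * z⁻¹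
          + 2 * (Real.pi : ℂ) * Complex.I * ∑ j, (((Aᵀ)⁻¹ *ᵥ k) j : ℂ) * w j) := by
  have hz0 : z ≠ 0 := by rintro rfl; simp at hz
  have hpi : (Real.pi : ℂ) ≠ 0 := by exact_mod_cast Real.pi_ne_zero
  set p : Fin d → ℝ := (Aᵀ)⁻¹ *ᵥ k with hp
  have hkp (x : Fin d → ℝ) : ∑ i, (k i : ℂ) * x i = ∑ j, (p j : ℂ) * ((A *ᵥ x) j : ℝ) := by
    have : k ⬝ᵥ x = p ⬝ᵥ (A *ᵥ x) := by
      rw [Matrix.dotProduct_mulVec, ← Matrix.mulVec_transpose, hp, Matrix.mulVec_mulVec,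
        Matrix.mul_nonsing_inv _ (by rwa [Matrix.det_transpose]), Matrix.one_mulVec]
    exact_mod_cast this
  set b : ℂ := Real.pi * (-Complex.I * z) with hb
  set c : Fin d → ℂ := fun j ↦ 2 * Real.pi * Complex.I * (z * w j - p j) with hc
  have hre : 0 < (-Complex.I * z).re := by simpa using hz
  have hbre : 0 < b.re := by
    rw [hb, Complex.re_ofReal_mul]
    exact mul_pos Real.pi_pos hre
  let g : (Fin d → ℝ) → ℂ := fun y ↦ Complex.exp (Real.pi * Complex.I * z * ∑ j, w j ^ 2) *
    Complex.exp (-b * ∑ j, (y j : ℂ) ^ 2 + ∑ j, c j * y j)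
  have hpt (x : Fin d → ℝ) :
      Complex.exp (-2 * Real.pi * Complex.I * ∑ i, (k i : ℂ) * x i) * thetaGaussian A z w x =
      g (A *ᵥ x) := by
    simp only [g, thetaGaussian, hkp, ← Complex.exp_add]
    congr 1
    simp only [Finset.mul_sum, ← Finset.sum_add_distrib]
    refine Finset.sum_congr rfl fun j _ ↦ ?_
    rw [hb, hc]
    ring
  rw [funext hpt, integral_comp_mulVec hA (g := g) (by fun_prop), integral_const_mul,
    GaussianFourier.integral_cexp_neg_mul_sum_add hbre, Fintype.card_fin]
  have hpow : (Real.pi / b) ^ (d / 2 : ℂ) = (-Complex.I * z) ^ (-(d : ℂ) / 2) := by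
    have harg : (-Complex.I * z).arg ≠ Real.pi := fun h ↦ by
      linarith [(Complex.arg_eq_pi_iff.mp h).1]
    rw [hb, div_mul_cancel_left₀ hpi, Complex.inv_cpow _ _ harg, neg_div, Complex.cpow_neg]
  have hexp : Complex.exp (Real.pi * Complex.I * z * ∑ j, w j ^ 2) *
      Complex.exp ((∑ j, c j ^ 2) / (4 * b)) =
      Complex.exp (-(Real.pi : ℂ) * Complex.I * ((∑ j, p j ^ 2 : ℝ) : ℂ) * z⁻¹
          + 2 * (Real.pi : ℂ) * Complex.I * ∑ j, (p j : ℂ) * w j) := by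
    rw [← Complex.exp_add]
    congr 1
    push_cast
    simp only [Finset.mul_sum, Finset.sum_mul, Finset.sum_div, ← Finset.sum_add_distrib]
    refine Finset.sum_congr rfl fun j _ ↦ ?_
    rw [hb, hc]
    field_simp
    ring
  rw [← hpow, ← hexp]
  ring

theorem summable_dual_theta (hA : IsUnit A.det) (hz : 0 < z.im) (w : Fin d → ℂ) :
    Summable fun k : Fin d → ℤ ↦ Complex.exp
      (-(Real.pi : ℂ) * Complex.I * ((∑ j, ((Aᵀ)⁻¹ *ᵥ fun i ↦ (k i : ℝ)) j ^ 2 : ℝ) : ℂ) * z⁻¹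
        + 2 * (Real.pi : ℂ) * Complex.I * ∑ j, (((Aᵀ)⁻¹ *ᵥ fun i ↦ (k i : ℝ)) j : ℂ) * w j) := by
  have hz0 : z ≠ 0 := by rintro rfl; simp at hz
  have hA' : IsUnit ((Aᵀ)⁻¹).det :=
    Matrix.isUnit_nonsing_inv_det _ (by rwa [Matrix.det_transpose])
  have hz' : 0 < (-z⁻¹).im := by
    rw [Complex.neg_im, Complex.inv_im, neg_div, neg_neg]
    exact div_pos hz (Complex.normSq_pos.mpr hz0)
  convert! (summable_thetaGaussian hA' hz' fun j ↦ -(z * w j)).mul_left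
    (Complex.exp (Real.pi * Complex.I * z * ∑ j, w j ^ 2)) using 2 with k
  rw [thetaGaussian, ← Complex.exp_add]
  congr 1
  push_cast
  simp only [Finset.mul_sum, Finset.sum_mul, ← Finset.sum_add_distrib]
  refine Finset.sum_congr rfl fun j _ ↦ ?_
  field_simp
  ring

end Gaussian

/-- **Theta transformation formula with characteristic** (slice form of Theorem 4.7): for
`d ≥ 1`, `A` an invertible real `d × d` matrix, `z ∈ ℂ` with `Im z > 0` and `w ∈ ℂ^d`,
`∑_{m∈ℤ^d} exp(πiz ∑ⱼ((Am)ⱼ+wⱼ)²)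
  = (−iz)^{−d/2} |det A|⁻¹ ∑_{k∈ℤ^d} exp(−πi‖(Aᵀ)⁻¹k‖² z⁻¹ + 2πi ∑ⱼ((Aᵀ)⁻¹k)ⱼwⱼ)`. -/
theorem theta_transformation_characteristic (d : ℕ) (hd : 1 ≤ d)
    (A : Matrix (Fin d) (Fin d) ℝ) (hA : IsUnit A.det)
    (z : ℂ) (hz : 0 < z.im) (w : Fin d → ℂ) :
    ∑' m : Fin d → ℤ,
        Complex.exp ((Real.pi : ℂ) * Complex.I * z *
          ∑ j, ((A.mulVec (fun i => (m i : ℝ)) j : ℂ) + w j) ^ 2)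
      = (-Complex.I * z) ^ (-(d : ℂ) / 2) * ((|A.det| : ℝ)⁻¹ : ℂ) *
        ∑' k : Fin d → ℤ,
          Complex.exp (-(Real.pi : ℂ) * Complex.I *
              ((∑ j, ((Aᵀ)⁻¹.mulVec (fun i => (k i : ℝ)) j) ^ 2 : ℝ) : ℂ) * z⁻¹
            + 2 * (Real.pi : ℂ) * Complex.I *
              ∑ j, ((Aᵀ)⁻¹.mulVec (fun i => (k i : ℝ)) j : ℂ) * w j) := by
  have hfourier (k : Fin d → ℤ) := fourier_thetaGaussian hA hz w fun i ↦ (k i : ℝ)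
  simp only [Complex.ofReal_intCast] at hfourier
  rw [← tsum_mul_left, ← tsum_congr hfourier]
  refine tsum_eq_tsum_integral_exp (f := thetaGaussian A z w) continuous_thetaGaussian
    (integrable_thetaGaussian hA hz w) (thetaGaussian_locally_summable hA hz w) ?_
  rw [funext hfourier]
  exact (summable_dual_theta hA hz w).mul_left _
end

section
/- First conjugated theta relation (slice form of equation (4.14)): let d ≥ 1 and let A be an invertible real d×d matrix whose lattice L = A·ℤ^d is self-dual, i.e. A·ℤ^d = (Aᵀ)⁻¹·ℤ^d as subsets of ℝ^d. Fix q̃ = (1/2)·A·m₀ for some m₀ ∈ ℤ^d. Then for every z ∈ ℂ with Im z > 0: ∑_{m∈ℤ^d} exp(πi‖Am + q̃‖²·z) = (−iz)^{−d/2} · ∑_{m∈ℤ^d} exp(πi‖Am‖²·(−z⁻¹) + 2πi⟨Am, q̃⟩). -/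
open Matrix

/-- The Schur complement of the top left entry of a matrix. -/
noncomputable def schurCompl {d : ℕ} (G : Matrix (Fin (d + 1)) (Fin (d + 1)) ℝ) :
    Matrix (Fin d) (Fin d) ℝ :=
  Matrix.of fun i j => G i.succ j.succ - G i.succ 0 * G 0 j.succ / G 0 0

/-- The first row of a matrix without its first entry, divided by that entry. -/
noncomputable def firstRowSlope {d : ℕ} (G : Matrix (Fin (d + 1)) (Fin (d + 1)) ℝ) :
    Fin d → ℝ :=
  fun i => G 0 i.succ / G 0 0

section SchurComplement

variable {d : ℕ} {G : Matrix (Fin (d + 1)) (Fin (d + 1)) ℝ}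

theorem mulVec_zero_eq (h0 : G 0 0 ≠ 0) (t : Fin (d + 1) → ℝ) :
    (G *ᵥ t) 0 = G 0 0 * (t 0 + firstRowSlope G ⬝ᵥ Fin.tail t) := by
  simp only [mulVec, dotProduct, Fin.sum_univ_succ, firstRowSlope, Fin.tail, mul_add,
    Finset.mul_sum]
  congr 1
  refine Finset.sum_congr rfl fun i _ => ?_
  field_simp

theorem tail_mulVec_eq (hG : G.PosDef) (t : Fin (d + 1) → ℝ) :
    Fin.tail (G *ᵥ t) = (G *ᵥ t) 0 • firstRowSlope G + schurCompl G *ᵥ Fin.tail t := by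
  have h0 : G 0 0 ≠ 0 := hG.diag_pos.ne'
  ext i
  have hsymm : G i.succ 0 = G 0 i.succ := by simpa using hG.isHermitian.apply 0 i.succ
  simp only [mulVec_zero_eq h0, Fin.tail, Pi.add_apply, Pi.smul_apply, smul_eq_mul]
  simp only [mulVec, dotProduct, Fin.sum_univ_succ, firstRowSlope, schurCompl, of_apply, Fin.tail,
    hsymm, sub_mul, Finset.sum_sub_distrib]
  have : ∑ j : Fin d, G 0 i.succ * G 0 j.succ / G 0 0 * t j.succ =
      G 0 i.succ * ∑ j : Fin d, G 0 j.succ / G 0 0 * t j.succ := by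
    rw [Finset.mul_sum]
    exact Finset.sum_congr rfl fun j _ => by ring
  rw [this]
  field_simp
  ring

theorem dotProduct_eq_zero_add_tail (s t : Fin (d + 1) → ℝ) :
    s ⬝ᵥ t = s 0 * t 0 + Fin.tail s ⬝ᵥ Fin.tail t := by
  simp [dotProduct, Fin.sum_univ_succ, Fin.tail]

/-- Completing the square in the first variable. -/
theorem dotProduct_mulVec_eq_sq_add (hG : G.PosDef) (t : Fin (d + 1) → ℝ) :
    t ⬝ᵥ G *ᵥ t = G 0 0 * (t 0 + firstRowSlope G ⬝ᵥ Fin.tail t) ^ 2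
      + Fin.tail t ⬝ᵥ schurCompl G *ᵥ Fin.tail t := by
  rw [dotProduct_eq_zero_add_tail, tail_mulVec_eq hG, dotProduct_add, dotProduct_smul,
    mulVec_zero_eq hG.diag_pos.ne', dotProduct_comm (Fin.tail t), smul_eq_mul]
  ring

theorem Matrix.PosDef.schurCompl (hG : G.PosDef) : (schurCompl G).PosDef := by
  refine Matrix.PosDef.of_dotProduct_mulVec_pos ?_ fun t ht => ?_
  · ext i j
    have h (i j) : G i j = G j i := by simpa using hG.isHermitian.apply j i
    simp [_root_.schurCompl, h j.succ i.succ, h j.succ 0, h 0 i.succ, mul_comm]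
  · have hne : (Fin.cons (-(firstRowSlope G ⬝ᵥ t)) t : Fin (d + 1) → ℝ) ≠ 0 := fun h =>
      ht (by ext i; simpa using congrFun h i.succ)
    have := hG.dotProduct_mulVec_pos hne
    rw [star_trivial, dotProduct_mulVec_eq_sq_add hG] at this
    simpa using this

/-- The form of the inverse matrix, in terms of the inverse of the Schur complement. -/
theorem dotProduct_inv_mulVec_eq (hG : G.PosDef) (s : Fin (d + 1) → ℝ) :
    s ⬝ᵥ G⁻¹ *ᵥ s = s 0 ^ 2 / G 0 0
      + (Fin.tail s - s 0 • firstRowSlope G) ⬝ᵥ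
        (_root_.schurCompl G)⁻¹ *ᵥ (Fin.tail s - s 0 • firstRowSlope G) := by
  have hu : IsUnit G.det := (isUnit_iff_isUnit_det _).1 hG.isUnit
  have hS : IsUnit (_root_.schurCompl G).det := (isUnit_iff_isUnit_det _).1 hG.schurCompl.isUnit
  have h0 : G 0 0 ≠ 0 := hG.diag_pos.ne'
  obtain ⟨t, rfl⟩ : ∃ t, s = G *ᵥ t := ⟨G⁻¹ *ᵥ s, by simp [mul_nonsing_inv _ hu]⟩
  rw [mulVec_mulVec, nonsing_inv_mul _ hu, one_mulVec, tail_mulVec_eq hG, add_sub_cancel_left,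
    mulVec_mulVec, nonsing_inv_mul _ hS, one_mulVec, dotProduct_comm,
    dotProduct_mulVec_eq_sq_add hG, mulVec_zero_eq h0, dotProduct_comm (_ *ᵥ _)]
  field_simp

end SchurComplement

open Complex in
/-- One-dimensional Poisson summation for a shifted Gaussian with a character. -/
theorem tsum_int_gaussian_shift {a : ℝ} (ha : 0 < a) {w : ℂ} (hw : 0 < w.re) (c y : ℝ) :
    ∑' m : ℤ, cexp (-Real.pi * w * (a * (m + c) ^ 2 : ℝ) + 2 * Real.pi * I * (y * (m + c) : ℝ)) =
      ((1 / √a : ℝ) * w ^ (-(1 : ℂ) / 2)) *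
        ∑' n : ℤ, cexp (-Real.pi / w * ((n - y) ^ 2 / a : ℝ) + 2 * Real.pi * I * (n * c : ℝ)) := by
  have hw0 : w ≠ 0 := fun h => by simp [h] at hw
  have ha0 : (a : ℂ) ≠ 0 := by exact_mod_cast ha.ne'
  have hre : 0 < (a * w).re := by rw [re_ofReal_mul]; positivity
  have hpow : 1 / (a * w : ℂ) ^ (1 / 2 : ℂ) = (1 / √a : ℝ) * w ^ (-(1 : ℂ) / 2) := by
    have h1 : ((√a : ℝ) : ℂ) = (a : ℂ) ^ (1 / 2 : ℂ) := by
      rw [Real.sqrt_eq_rpow, ofReal_cpow ha.le]; norm_num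
    have h2 : (a * w : ℂ) ^ (1 / 2 : ℂ) = (a : ℂ) ^ (1 / 2 : ℂ) * w ^ (1 / 2 : ℂ) := by
      rw [cpow_def_of_ne_zero (mul_ne_zero ha0 hw0), cpow_def_of_ne_zero ha0,
        cpow_def_of_ne_zero hw0, ← exp_add, log_ofReal_mul ha hw0, ofReal_log ha.le, add_mul]
    rw [h2, ofReal_div, h1, neg_div, cpow_neg, ofReal_one]
    field_simp
  have key := Complex.tsum_exp_neg_quadratic hre (-(a * w) * c + I * y)
  calc
    _ = cexp (-Real.pi * (a * w) * c ^ 2 + 2 * Real.pi * I * (y * c)) *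
        ∑' n : ℤ, cexp (-Real.pi * (a * w) * n ^ 2 +
          2 * Real.pi * (-(a * w) * c + I * y) * n) := by
      rw [← tsum_mul_left]
      refine tsum_congr fun n => ?_
      rw [← exp_add]
      push_cast
      congr 1
      ring
    _ = _ := by
      rw [key, hpow, mul_left_comm, ← tsum_mul_left]
      congr 1
      refine tsum_congr fun n => ?_
      rw [← exp_add]
      push_cast
      congr 1
      field_simp
      ring_nf
      simp only [I_sq, I_pow_three, I_pow_four]
      ring

theorem summable_int_gaussian_shift {a : ℝ} (ha : 0 < a) (c : ℝ) :
    Summable fun m : ℤ => Real.exp (-Real.pi * (a * (m + c) ^ 2)) := by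
  have h := ((summable_jacobiTheta₂_term_iff ((a * c : ℝ) * Complex.I) (a * Complex.I)).2
    (by simpa using ha)).norm.mul_left (Real.exp (-Real.pi * (a * c ^ 2)))
  refine h.congr fun m => ?_
  rw [norm_jacobiTheta₂_term, ← Real.exp_add, Complex.im_ofReal_mul, Complex.im_ofReal_mul,
    Complex.I_im]
  congr 1
  ring

open Complex in
theorem tsum_int_gaussian_shift_le {a : ℝ} (ha : 0 < a) (c : ℝ) :
    ∑' m : ℤ, Real.exp (-Real.pi * (a * (m + c) ^ 2)) ≤
      1 / √a * ∑' m : ℤ, Real.exp (-Real.pi * (a⁻¹ * m ^ 2)) := by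
  have key := congrArg norm (tsum_int_gaussian_shift ha (w := 1) (by simp) c 0)
  have hnorm (n : ℤ) : ‖cexp (-Real.pi / 1 * ((n - (0 : ℝ)) ^ 2 / a : ℝ)
      + 2 * Real.pi * I * (n * c : ℝ))‖ = Real.exp (-Real.pi * (a⁻¹ * n ^ 2)) := by
    rw [norm_exp]
    congr 1
    simp [-ofReal_mul, -ofReal_div, -ofReal_pow]
    ring
  have hleft : ∑' m : ℤ, cexp (-Real.pi * 1 * (a * (m + c) ^ 2 : ℝ)
      + 2 * Real.pi * I * ((0 : ℝ) * (m + c) : ℝ)) =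
      (∑' m : ℤ, Real.exp (-Real.pi * (a * (m + c) ^ 2)) : ℝ) := by
    rw [ofReal_tsum]
    refine tsum_congr fun m => ?_
    push_cast
    simp
  rw [hleft, one_cpow, mul_one, norm_mul, norm_real, norm_real,
    Real.norm_of_nonneg (tsum_nonneg fun _ => (Real.exp_pos _).le),
    Real.norm_of_nonneg (by positivity)] at key
  rw [key]
  gcongr
  have hs := summable_int_gaussian_shift (inv_pos.2 ha) 0
  simp only [add_zero] at hs
  simp_rw [← hnorm]
  exact norm_tsum_le_tsum_norm (by simpa only [hnorm] using hs)

section Lattice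

variable {d : ℕ}

theorem tail_intCast_cons_add (k : ℤ) (m : Fin d → ℤ) (x : Fin (d + 1) → ℝ) :
    Fin.tail (fun i => ((Fin.cons k m : Fin (d + 1) → ℤ) i : ℝ) + x i) =
      fun i => (m i : ℝ) + Fin.tail x i := by
  ext i
  simp [Fin.tail]

/-- Summation over `ℤ ^ (d + 1)`, the first variable being the outer one. -/
theorem tsum_fin_succ_int {f : (Fin (d + 1) → ℤ) → ℂ} (hf : Summable f) :
    ∑' m, f m = ∑' (k : ℤ) (m : Fin d → ℤ), f (Fin.cons k m) := by
  let e := Fin.consEquiv (n := d) fun _ => ℤ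
  rw [← e.tsum_eq]
  exact (e.summable_iff.2 hf).tsum_prod

/-- Summation over `ℤ ^ (d + 1)`, the first variable being the inner one. -/
theorem tsum_fin_succ_int' {f : (Fin (d + 1) → ℤ) → ℂ} (hf : Summable f) :
    ∑' m, f m = ∑' (m : Fin d → ℤ) (k : ℤ), f (Fin.cons k m) := by
  let e := (Equiv.prodComm _ _).trans (Fin.consEquiv (n := d) fun _ => ℤ)
  rw [← e.tsum_eq]
  exact (e.summable_iff.2 hf).tsum_prod

/-- Translated Gaussians are summable over `ℤ ^ d`. -/
theorem summable_gaussian_shift {d : ℕ} {G : Matrix (Fin d) (Fin d) ℝ} (hG : G.PosDef) {u : ℝ}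
    (hu : 0 < u) (x : Fin d → ℝ) :
    Summable fun m : Fin d → ℤ => Real.exp (-Real.pi * u *
      ((fun i => (m i : ℝ) + x i) ⬝ᵥ G *ᵥ fun i => (m i : ℝ) + x i)) := by
  induction d with
  | zero => exact Summable.of_finite
  | succ d ih =>
    have ha : 0 < u * G 0 0 := mul_pos hu hG.diag_pos
    rw [← ((Equiv.prodComm _ _).trans (Fin.consEquiv fun _ => ℤ)).summable_iff]
    have hterm (p : (Fin d → ℤ) × ℤ) : Real.exp (-Real.pi * u *
        ((fun i => ((Fin.cons p.2 p.1 : Fin (d + 1) → ℤ) i : ℝ) + x i) ⬝ᵥ G *ᵥ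
          fun i => ((Fin.cons p.2 p.1 : Fin (d + 1) → ℤ) i : ℝ) + x i)) =
        Real.exp (-Real.pi * u * ((fun i => (p.1 i : ℝ) + Fin.tail x i) ⬝ᵥ
          schurCompl G *ᵥ fun i => (p.1 i : ℝ) + Fin.tail x i)) *
        Real.exp (-Real.pi * (u * G 0 0 * (p.2 +
          (x 0 + firstRowSlope G ⬝ᵥ fun i => (p.1 i : ℝ) + Fin.tail x i)) ^ 2)) := by
      rw [dotProduct_mulVec_eq_sq_add hG, tail_intCast_cons_add, Fin.cons_zero, ← Real.exp_add]
      congr 1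
      ring
    refine (summable_congr hterm).2 ?_
    rw [summable_prod_of_nonneg fun p => by positivity]
    dsimp only
    refine ⟨fun m => Summable.mul_left _ (summable_int_gaussian_shift ha _), ?_⟩
    refine ((ih hG.schurCompl (Fin.tail x)).mul_right
      (1 / √(u * G 0 0) * ∑' m : ℤ, Real.exp (-Real.pi * ((u * G 0 0)⁻¹ * m ^ 2)))).of_nonneg_of_le
      (fun m => tsum_nonneg fun k => by positivity) fun m => ?_
    rw [tsum_mul_left]
    exact mul_le_mul_of_nonneg_left (tsum_int_gaussian_shift_le ha _) (Real.exp_pos _).le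

open Complex in
theorem summable_cexp_gaussian_shift {G : Matrix (Fin d) (Fin d) ℝ} (hG : G.PosDef) {w : ℂ}
    (hw : 0 < w.re) (x : Fin d → ℝ) (φ : (Fin d → ℤ) → ℝ) :
    Summable fun m : Fin d → ℤ => cexp (-Real.pi * w *
      ((fun i => (m i : ℝ) + x i) ⬝ᵥ G *ᵥ fun i => (m i : ℝ) + x i : ℝ)
        + 2 * Real.pi * I * (φ m : ℝ)) := by
  refine Summable.of_norm ((summable_gaussian_shift hG hw x).congr fun m => ?_)
  rw [norm_exp]
  congr 1
  simp

open Complex in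
/-- Poisson summation for Gaussians on `ℤ ^ d`, up to the value of the positive constant. -/
theorem exists_tsum_gaussian_shift {d : ℕ} {G : Matrix (Fin d) (Fin d) ℝ} (hG : G.PosDef) :
    ∃ D : ℝ, 0 < D ∧ ∀ (w : ℂ), 0 < w.re → ∀ x y : Fin d → ℝ,
      ∑' m : Fin d → ℤ, cexp (-Real.pi * w *
          ((fun i => (m i : ℝ) + x i) ⬝ᵥ G *ᵥ fun i => (m i : ℝ) + x i : ℝ)
          + 2 * Real.pi * I * (y ⬝ᵥ fun i => (m i : ℝ) + x i : ℝ)) =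
        D * w ^ (-(d : ℂ) / 2) * ∑' n : Fin d → ℤ, cexp (-Real.pi * w⁻¹ *
          ((fun i => (n i : ℝ) + -y i) ⬝ᵥ G⁻¹ *ᵥ fun i => (n i : ℝ) + -y i : ℝ)
          + 2 * Real.pi * I * ((fun i => (n i : ℝ)) ⬝ᵥ x : ℝ)) := by
  induction d with
  | zero => exact ⟨1, one_pos, fun w hw x y => by simp⟩
  | succ d ih =>
    obtain ⟨D, hD, h⟩ := ih hG.schurCompl
    have ha : 0 < G 0 0 := hG.diag_pos
    refine ⟨1 / √(G 0 0) * D, by positivity, fun w hw x y => ?_⟩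
    have hw0 : w ≠ 0 := fun h => by simp [h] at hw
    have hw' : 0 < w⁻¹.re := by
      rw [inv_re]
      exact div_pos hw (normSq_pos.2 hw0)
    set a := G 0 0 with ha_def
    set l := firstRowSlope G
    set S := schurCompl G with hS_def
    let v (m : Fin d → ℤ) : Fin d → ℝ := fun i => (m i : ℝ) + Fin.tail x i
    let y' (n : ℤ) : Fin d → ℝ := Fin.tail y + (n - y 0) • l
    -- the summand after Poisson summation in the first variable
    let F (m : Fin d → ℤ) (n : ℤ) : ℂ :=
      cexp (-Real.pi * w⁻¹ * ((n - y 0) ^ 2 / a : ℝ) + 2 * Real.pi * I * (n * x 0 : ℝ)) *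
        cexp (-Real.pi * w * (v m ⬝ᵥ S *ᵥ v m : ℝ) + 2 * Real.pi * I * (y' n ⬝ᵥ v m : ℝ))
    have hF : Summable (Function.uncurry F) := by
      have h1 := summable_int_gaussian_shift (div_pos hw' ha) (-y 0)
      have h2 := summable_gaussian_shift hG.schurCompl hw (Fin.tail x)
      refine Summable.of_norm ((h2.mul_of_nonneg h1 (fun _ => (Real.exp_pos _).le)
        fun _ => (Real.exp_pos _).le).congr fun p => ?_)
      simp only [Function.uncurry, F, norm_mul, norm_exp]
      rw [mul_comm]
      congr 2
      · have h3 : -Real.pi * w⁻¹ * ((p.2 - y 0) ^ 2 / a : ℝ) + 2 * Real.pi * I * (p.2 * x 0 : ℝ) =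
            ((-Real.pi * ((p.2 - y 0) ^ 2 / a) : ℝ) : ℂ) * w⁻¹
              + ((2 * Real.pi * (p.2 * x 0) : ℝ) : ℂ) * I := by
          push_cast
          ring
        rw [h3, add_re, re_ofReal_mul, re_ofReal_mul, I_re]
        ring
      · simp [v, S]
    have hfst (m : Fin d → ℤ) : ∑' k : ℤ, cexp (-Real.pi * w *
          ((fun i => ((Fin.cons k m : Fin (d + 1) → ℤ) i : ℝ) + x i) ⬝ᵥ G *ᵥ
            fun i => ((Fin.cons k m : Fin (d + 1) → ℤ) i : ℝ) + x i : ℝ)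
          + 2 * Real.pi * I *
            (y ⬝ᵥ fun i => ((Fin.cons k m : Fin (d + 1) → ℤ) i : ℝ) + x i : ℝ)) =
        ((1 / √a : ℝ) * w ^ (-(1 : ℂ) / 2)) * ∑' n : ℤ, F m n := by
      have key := tsum_int_gaussian_shift ha hw (x 0 + l ⬝ᵥ v m) (y 0)
      have hl := congrArg (· * cexp (-Real.pi * w * (v m ⬝ᵥ S *ᵥ v m : ℝ)
        + 2 * Real.pi * I * ((Fin.tail y - y 0 • l) ⬝ᵥ v m : ℝ))) key
      simp only [mul_assoc _ (tsum _), ← tsum_mul_right] at hl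
      refine (tsum_congr fun k => ?_).trans (hl.trans (congrArg _ (tsum_congr fun n => ?_)))
      · rw [dotProduct_mulVec_eq_sq_add hG, dotProduct_eq_zero_add_tail y, tail_intCast_cons_add,
          Fin.cons_zero, ← exp_add, sub_dotProduct, smul_dotProduct]
        congr 1
        simp only [smul_eq_mul]
        push_cast
        ring
      · simp only [F, y', ← exp_add, add_dotProduct, sub_dotProduct, smul_dotProduct]
        congr 1
        simp only [smul_eq_mul]
        push_cast
        ring
    have hsnd (n : ℤ) : ∑' m : Fin d → ℤ, F m n =
        D * w ^ (-(d : ℂ) / 2) * ∑' k : Fin d → ℤ, cexp (-Real.pi * w⁻¹ *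
          ((fun i => ((Fin.cons n k : Fin (d + 1) → ℤ) i : ℝ) + -y i) ⬝ᵥ G⁻¹ *ᵥ
            fun i => ((Fin.cons n k : Fin (d + 1) → ℤ) i : ℝ) + -y i : ℝ)
          + 2 * Real.pi * I *
            ((fun i => ((Fin.cons n k : Fin (d + 1) → ℤ) i : ℝ)) ⬝ᵥ x : ℝ)) := by
      rw [tsum_mul_left, h w hw (Fin.tail x) (y' n), mul_left_comm, ← tsum_mul_left]
      congr 1
      refine tsum_congr fun k => ?_
      have ht : Fin.tail (fun i => ((Fin.cons n k : Fin (d + 1) → ℤ) i : ℝ) + -y i)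
          - ((n : ℝ) + -y 0) • l = fun i => (k i : ℝ) + -y' n i := by
        ext i
        simp [Fin.tail, y']
        ring
      rw [dotProduct_inv_mulVec_eq hG, dotProduct_eq_zero_add_tail _ x, Fin.cons_zero, ht,
        ← exp_add]
      congr 1
      have hn : Fin.tail (fun i => ((Fin.cons n k : Fin (d + 1) → ℤ) i : ℝ)) = fun i => (k i : ℝ) :=
        rfl
      rw [hn, ← ha_def, ← hS_def]
      push_cast
      ring
    have hpow : w ^ (-((d + 1 : ℕ) : ℂ) / 2) = w ^ (-(1 : ℂ) / 2) * w ^ (-(d : ℂ) / 2) := by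
      rw [← cpow_add _ _ hw0]
      congr 1
      push_cast
      ring
    have hleft := summable_cexp_gaussian_shift hG hw x
      fun m => y ⬝ᵥ fun i => (m i : ℝ) + x i
    have hright := summable_cexp_gaussian_shift hG.inv hw' (fun i => -y i)
      fun n => (fun i => (n i : ℝ)) ⬝ᵥ x
    rw [tsum_fin_succ_int' hleft, tsum_fin_succ_int hright, tsum_congr hfst, tsum_mul_left,
      ← hF.tsum_comm, tsum_congr hsnd, tsum_mul_left, hpow]
    push_cast
    ring

end Lattice

theorem dotProduct_transpose_mul_self_mulVec {d : ℕ} (B : Matrix (Fin d) (Fin d) ℝ)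
    (t : Fin d → ℝ) : t ⬝ᵥ (Bᵀ * B) *ᵥ t = ∑ j, (B *ᵥ t) j ^ 2 := by
  rw [← mulVec_mulVec, dotProduct_mulVec, vecMul_transpose]
  simp [dotProduct, sq]

/-- **First conjugated theta relation** (slice form of equation (4.14)): for a self-dual
lattice `L = A·ℤ^d` and `q̃ = (1/2)·A·m₀`, for every `z` with `Im z > 0`,
`∑_{m∈ℤ^d} exp(πi‖Am+q̃‖²z) = (−iz)^{−d/2} ∑_{m∈ℤ^d} exp(πi‖Am‖²(−z⁻¹) + 2πi⟨Am,q̃⟩)`. -/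
theorem first_conjugated_theta_relation (d : ℕ) (hd : 1 ≤ d)
    (A : Matrix (Fin d) (Fin d) ℝ) (hA : IsUnit A.det)
    (hself : (Set.range fun m : Fin d → ℤ => A.mulVec fun i => (m i : ℝ))
      = Set.range fun k : Fin d → ℤ => (Aᵀ)⁻¹.mulVec fun i => (k i : ℝ))
    (m₀ : Fin d → ℤ) (qt : Fin d → ℝ)
    (hqt : qt = (1 / 2 : ℝ) • A.mulVec fun i => (m₀ i : ℝ))
    (z : ℂ) (hz : 0 < z.im) :
    ∑' m : Fin d → ℤ,
        Complex.exp ((Real.pi : ℂ) * Complex.I *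
          ((∑ j, (A.mulVec (fun i => (m i : ℝ)) j + qt j) ^ 2 : ℝ) : ℂ) * z)
      = (-Complex.I * z) ^ (-(d : ℂ) / 2) *
        ∑' m : Fin d → ℤ,
          Complex.exp ((Real.pi : ℂ) * Complex.I *
              ((∑ j, (A.mulVec (fun i => (m i : ℝ)) j) ^ 2 : ℝ) : ℂ) * (-z⁻¹)
            + 2 * (Real.pi : ℂ) * Complex.I *
              ((∑ j, A.mulVec (fun i => (m i : ℝ)) j * qt j : ℝ) : ℂ)) := by
  have hAT : IsUnit Aᵀ.det := by rwa [det_transpose]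
  have hinjA : Function.Injective A.mulVec :=
    mulVec_injective_of_isUnit ((isUnit_iff_isUnit_det _).2 hA)
  have hinjB : Function.Injective (Aᵀ)⁻¹.mulVec :=
    mulVec_injective_of_isUnit ((isUnit_iff_isUnit_det _).2 (isUnit_nonsing_inv_det _ hAT))
  have hcast : Function.Injective fun (m : Fin d → ℤ) (i : Fin d) => (m i : ℝ) :=
    fun m n h => funext fun i => Int.cast_injective (congrFun h i)
  have hG : (Aᵀ * A).PosDef := by
    simpa using Matrix.PosDef.conjTranspose_mul_self A hinjA
  have hGinv : (Aᵀ * A)⁻¹ = ((Aᵀ)⁻¹)ᵀ * (Aᵀ)⁻¹ := by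
    rw [Matrix.mul_inv_rev, transpose_nonsing_inv, transpose_transpose]
  -- self-duality lets sums over the lattice be rewritten as sums over the dual lattice
  have hdual (g : (Fin d → ℝ) → ℂ) : ∑' n : Fin d → ℤ, g ((Aᵀ)⁻¹ *ᵥ fun i => (n i : ℝ)) =
      ∑' m : Fin d → ℤ, g (A *ᵥ fun i => (m i : ℝ)) := by
    rw [← tsum_range g (g := fun m : Fin d → ℤ => A *ᵥ fun i => (m i : ℝ)) (hinjA.comp hcast),
      hself]
    exact (tsum_range g (hinjB.comp hcast)).symm
  obtain ⟨D, hD, hpoisson⟩ := exists_tsum_gaussian_shift hG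
  simp only [hGinv, dotProduct_transpose_mul_self_mulVec] at hpoisson
  have hD1 : (D : ℂ) = 1 := by
    have h := hpoisson 1 (by simp) 0 0
    have hsum := summable_gaussian_shift hG one_pos 0
    simp only [Pi.zero_apply, neg_zero, add_zero, zero_dotProduct, dotProduct_zero,
      Complex.one_cpow, inv_one, mul_one, Complex.ofReal_zero, mul_zero,
      dotProduct_transpose_mul_self_mulVec] at h hsum
    rw [hdual fun v => Complex.exp (-Real.pi * (∑ j, v j ^ 2 : ℝ))] at h
    have hne : ∑' m : Fin d → ℤ, Complex.exp (-Real.pi *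
        (∑ j, (A *ᵥ fun i => (m i : ℝ)) j ^ 2 : ℝ)) ≠ 0 := by
      have hpos := hsum.tsum_pos (fun m => (Real.exp_pos _).le) 0 (Real.exp_pos _)
      have := Complex.ofReal_ne_zero.2 hpos.ne'
      rw [Complex.ofReal_tsum] at this
      push_cast at this ⊢
      exact this
    exact (mul_right_cancel₀ hne (by rw [one_mul]; exact h)).symm
  set x : Fin d → ℝ := (1 / 2 : ℝ) • fun i => (m₀ i : ℝ) with hx
  have hAx : A *ᵥ x = qt := by rw [hqt, hx, mulVec_smul]
  have hpair (n : Fin d → ℝ) : n ⬝ᵥ x = ∑ j, ((Aᵀ)⁻¹ *ᵥ n) j * qt j := by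
    change _ = ((Aᵀ)⁻¹ *ᵥ n) ⬝ᵥ qt
    rw [← hAx, dotProduct_mulVec, ← mulVec_transpose, mulVec_mulVec, mul_nonsing_inv _ hAT,
      one_mulVec]
  have hre : 0 < (-Complex.I * z).re := by simpa using hz
  have key := hpoisson (-Complex.I * z) hre x 0
  have hinv : (-Complex.I * z)⁻¹ = Complex.I * z⁻¹ := by
    rw [mul_inv, inv_neg, Complex.inv_I, neg_neg]
  simp only [hpair, hD1, one_mul, Pi.zero_apply, neg_zero, add_zero, zero_dotProduct,
    Complex.ofReal_zero, mul_zero, hinv] at key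
  rw [hdual fun v => Complex.exp (-Real.pi * (Complex.I * z⁻¹) * (∑ j, v j ^ 2 : ℝ)
    + 2 * Real.pi * Complex.I * (∑ j, v j * qt j : ℝ))] at key
  refine Eq.trans (tsum_congr fun m => ?_) (key.trans ?_)
  · have hshift : (A *ᵥ fun i => (m i : ℝ) + x i) = (A *ᵥ fun i => (m i : ℝ)) + qt := by
      rw [← hAx, ← mulVec_add]
      rfl
    rw [hshift]
    simp only [Pi.add_apply]
    congr 1
    ring
  · congr 1
    refine tsum_congr fun m => ?_
    congr 1
    ring
end
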